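/- arXiv:0712.1428 — 2 statements merged into one kernel-verified Lean document; each statement's English description precedes it below -/
import Mathlib

section
/- Let f : ℝ³ → ℝ be a measurable, nonnegative, locally integrable function, and suppose that the normalized averages over Euclidean balls vanish in the limit: (1/vol(B_R)) ∫_{B_R} f → 0 as R → ∞, where B_R is the closed ball of radius R centered at the origin. Then for almost every unit vector ω on the unit sphere S² (with respect to the surface measure), liminf_{r → ∞} f(r·ω) = 0. In other words, a nonnegative function whose spatial average over the whole space vanishes must tend to zero along almost every direction approaching infinity. -/
open MeasureTheory Filter Metric

section Rays

variable {E : Type*} [NormedAddCommGroup E] [NormedSpace ℝ E] [FiniteDimensional ℝ E]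
  [MeasurableSpace E] [BorelSpace E] {μ : Measure E} [μ.IsAddHaarMeasure]

/-- A property that holds almost everywhere holds, on almost every ray, at almost every radius. -/
lemma ae_toSphere_ae_volumeIoiPow_of_ae {p : E → Prop} (hp : ∀ᵐ x ∂μ, p x) :
    ∀ᵐ ω : sphere (0 : E) 1 ∂μ.toSphere,
      ∀ᵐ r : Set.Ioi (0 : ℝ) ∂Measure.volumeIoiPow (Module.finrank ℝ E - 1),
        p ((r : ℝ) • (ω : E)) := by
  have hsub : ∀ᵐ x : ({0}ᶜ : Set E) ∂μ.comap (↑), p x := by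
    have hemb := MeasurableEmbedding.subtype_coe (measurableSet_singleton (0 : E)).compl
    rw [← hemb.ae_map_iff (p := p), hemb.map_comap]
    exact ae_restrict_of_ae hp
  refine Measure.ae_ae_of_ae_prod
    (p := fun z : sphere (0 : E) 1 × Set.Ioi (0 : ℝ) => p ((z.2 : ℝ) • (z.1 : E))) ?_
  rw [← μ.measurePreserving_homeomorphUnitSphereProd.map_eq,
    (Homeomorph.measurableEmbedding _).ae_map_iff]
  filter_upwards [hsub] with x hx
  rwa [← homeomorphUnitSphereProd_symm_apply_coe, Homeomorph.symm_apply_apply]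

lemma MeasureTheory.LocallyIntegrable.integrableOn_closedBall_comp_smul {f : E → ℝ}
    (hf : LocallyIntegrable f μ) {R : ℝ} (hR : R ≠ 0) (ρ : ℝ) :
    IntegrableOn (fun x => f (R • x)) (closedBall 0 ρ) μ := by
  have h := (integrable_comp_smul_iff μ _ hR).2 ((integrable_indicator_iff
    measurableSet_closedBall).2 (hf.integrableOn_isCompact (isCompact_closedBall 0 (‖R‖ * ρ))))
  rw [← integrable_indicator_iff measurableSet_closedBall]
  refine h.congr (ae_of_all _ fun x => ?_)
  have hmem : R • x ∈ closedBall 0 (‖R‖ * ρ) ↔ x ∈ closedBall 0 ρ := by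
    rw [mem_closedBall_zero_iff, mem_closedBall_zero_iff, norm_smul,
      mul_le_mul_iff_right₀ (norm_pos_iff.2 hR)]
  by_cases hx : x ∈ closedBall 0 ρ
  · simp only [Set.indicator_of_mem hx, Set.indicator_of_mem (hmem.2 hx)]
  · simp only [Set.indicator_of_notMem hx, Set.indicator_of_notMem (hmem.not.2 hx)]

lemma setIntegral_closedBall_one_comp_smul (f : E → ℝ) {R : ℝ} (hR : 0 < R) :
    ∫ x in closedBall 0 1, f (R • x) ∂μ = μ.real (closedBall 0 1) *
      ((μ (closedBall 0 R)).toReal⁻¹ * ∫ x in closedBall 0 R, f x ∂μ) := by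
  have hball : μ.real (closedBall 0 1) ≠ 0 :=
    (ENNReal.toReal_pos (measure_closedBall_pos μ 0 one_pos).ne'
      measure_closedBall_lt_top.ne).ne'
  rw [Measure.setIntegral_comp_smul_of_pos μ f _ hR, smul_closedBall R 0 zero_le_one, smul_zero,
    Real.norm_of_nonneg hR.le, mul_one, Measure.addHaar_closedBall' μ 0 hR.le, ENNReal.toReal_mul,
    ENNReal.toReal_ofReal (by positivity), smul_eq_mul, ← measureReal_def]
  field_simp

/-- If the averages of a nonnegative function over large balls vanish in the limit, then almost
every point `x` of the unit ball satisfies `liminf f (n • x) = 0` along the integers. -/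
lemma ae_liminf_comp_natCast_smul_eq_zero {f : E → ℝ} (hf_meas : Measurable f)
    (hf_nonneg : ∀ x, 0 ≤ f x) (hf_loc : LocallyIntegrable f μ)
    (havg : Tendsto (fun R : ℝ => (μ (closedBall 0 R)).toReal⁻¹ * ∫ x in closedBall 0 R, f x ∂μ)
      atTop (nhds 0)) :
    ∀ᵐ x ∂μ, x ∈ closedBall 0 1 →
      liminf (fun n : ℕ => ENNReal.ofReal (f ((n : ℝ) • x))) atTop = 0 := by
  have hm : ∀ n : ℕ, Measurable fun x => ENNReal.ofReal (f ((n : ℝ) • x)) := fun n =>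
    (hf_meas.comp (measurable_const_smul (n : ℝ))).ennreal_ofReal
  have hlim : Tendsto (fun n : ℕ => ∫⁻ x in closedBall 0 1, ENNReal.ofReal (f ((n : ℝ) • x)) ∂μ)
      atTop (nhds 0) := by
    have h := ENNReal.tendsto_ofReal
      ((havg.comp tendsto_natCast_atTop_atTop).const_mul (μ.real (closedBall 0 1)))
    rw [mul_zero, ENNReal.ofReal_zero] at h
    refine h.congr' ?_
    filter_upwards [eventually_gt_atTop 0] with n hn
    have hn' : (0 : ℝ) < n := Nat.cast_pos.2 hn
    rw [← ofReal_integral_eq_lintegral_ofReal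
      (hf_loc.integrableOn_closedBall_comp_smul hn'.ne' 1) (ae_of_all _ fun _ => hf_nonneg _),
      setIntegral_closedBall_one_comp_smul f hn']
    rfl
  rw [← ae_restrict_iff' measurableSet_closedBall]
  refine (lintegral_eq_zero_iff (.liminf hm)).1 (le_antisymm ?_ bot_le)
  exact (lintegral_liminf_le hm).trans hlim.liminf_eq.le

end Rays

lemma Real.liminf_eq_zero_of_frequently_lt {α : Type*} {l : Filter α} {u : α → ℝ}
    (hu : ∀ a, 0 ≤ u a) (h : ∀ ε > 0, ∃ᶠ a in l, u a < ε) : liminf u l = 0 := by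
  rw [liminf_eq]
  refine IsGreatest.csSup_eq ⟨.of_forall hu, fun a ha => ?_⟩
  by_contra! hpos
  obtain ⟨x, hx, hx'⟩ := ((h a hpos).and_eventually ha).exists
  exact hx.not_ge hx'

/-- A nonnegative locally integrable function on ℝ³ whose normalized averages over
balls `B_R` tend to `0` as `R → ∞` must satisfy `liminf_{r → ∞} f (r • ω) = 0`
for almost every direction `ω` on the unit sphere (w.r.t. the surface measure). -/
theorem liminf_along_ae_direction_eq_zero_of_average_tendsto_zero
    (f : EuclideanSpace ℝ (Fin 3) → ℝ)
    (hf_meas : Measurable f)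
    (hf_nonneg : ∀ x, 0 ≤ f x)
    (hf_loc : LocallyIntegrable f volume)
    (havg : Tendsto
      (fun R : ℝ => (volume (closedBall (0 : EuclideanSpace ℝ (Fin 3)) R)).toReal⁻¹ *
        ∫ x in closedBall (0 : EuclideanSpace ℝ (Fin 3)) R, f x)
      atTop (nhds 0)) :
    ∀ᵐ (ω : sphere (0 : EuclideanSpace ℝ (Fin 3)) 1) ∂((volume : Measure (EuclideanSpace ℝ (Fin 3))).toSphere),
      liminf (fun r : ℝ => f (r • (ω : EuclideanSpace ℝ (Fin 3)))) atTop = 0 := by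
  filter_upwards [ae_toSphere_ae_volumeIoiPow_of_ae
    (ae_liminf_comp_natCast_smul_eq_zero hf_meas hf_nonneg hf_loc havg)] with ω hω
  obtain ⟨r, hr1, hr⟩ : ∃ r : Set.Ioi (0 : ℝ), (r : ℝ) < 1 ∧
      liminf (fun n : ℕ => ENNReal.ofReal (f ((n : ℝ) • (r : ℝ) • (ω : EuclideanSpace ℝ (Fin 3)))))
        atTop = 0 := by
    have hpos : Measure.volumeIoiPow (Module.finrank ℝ (EuclideanSpace ℝ (Fin 3)) - 1)
        (Set.Iio ⟨1, Set.mem_Ioi.2 one_pos⟩) ≠ 0 := by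
      rw [Measure.volumeIoiPow_apply_Iio]
      simp only [one_pow, ne_eq, ENNReal.ofReal_eq_zero, not_le]
      positivity
    obtain ⟨r, hr, hr'⟩ := ((frequently_ae_mem_iff.2 hpos).and_eventually hω).exists
    have hr1 : (r : ℝ) < 1 := hr
    refine ⟨r, hr1, hr' ?_⟩
    simpa [norm_smul, abs_of_pos (Set.mem_Ioi.1 r.2)] using hr1.le
  refine Real.liminf_eq_zero_of_frequently_lt (fun _ => hf_nonneg _) fun ε hε => ?_
  have hfreq := frequently_lt_of_liminf_lt (by isBoundedDefault)
    (hr.trans_lt (ENNReal.ofReal_pos.2 hε))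
  have htop : Tendsto (fun n : ℕ => (n : ℝ) * (r : ℝ)) atTop atTop :=
    tendsto_natCast_atTop_atTop.atTop_mul_const r.2
  refine htop.frequently (hfreq.mono fun n hn => ?_)
  rw [mul_smul]
  exact (ENNReal.ofReal_lt_ofReal_iff hε).1 hn
end

section
/- Let a > 0, and define on ℝ × [0,∞) the functions ρ(t,x) = 15 a² cosh(a t)⁻⁴ cosh(3 a x)⁻⁴ and F(t,x) = cosh(a t)⁵ cosh(3 a x)^{4/3} sinh(3 a x). Then the spacetime average of ρ vanishes: (∫_{-n}^{n} ∫₀^{n} ρ(t,x) F(t,x) dx dt) / (∫_{-n}^{n} ∫₀^{n} F(t,x) dx dt) → 0 as n → ∞. Consequently (since the pressure is p = ρ/3) the spacetime averages of both the energy density and the pressure of the singularity-free solution vanish (Raychaudhuri's 1998 observation). -/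
open MeasureTheory Filter intervalIntegral Real

/-- The integral of `cosh (b x) ^ r * sinh (b x)` over `[0, n]`. -/
theorem integral_cosh_rpow_mul_sinh {b r : ℝ} (hb : b ≠ 0) (hr : r + 1 ≠ 0) (n : ℝ) :
    ∫ x in (0 : ℝ)..n, Real.cosh (b * x) ^ r * Real.sinh (b * x) =
      (Real.cosh (b * n) ^ (r + 1) - 1) / (b * (r + 1)) := by
  have hcont : Continuous fun x : ℝ => Real.cosh (b * x) ^ r * Real.sinh (b * x) :=
    ((Real.continuous_cosh.comp (continuous_const.mul continuous_id)).rpow_const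
      fun x => Or.inl (Real.cosh_pos _).ne').mul
      (Real.continuous_sinh.comp (continuous_const.mul continuous_id))
  have hderiv : ∀ x ∈ Set.uIcc 0 n,
      HasDerivAt (fun x : ℝ => Real.cosh (b * x) ^ (r + 1) / (b * (r + 1)))
        (Real.cosh (b * x) ^ r * Real.sinh (b * x)) x := by
    intro x _
    have h := ((((hasDerivAt_id x).const_mul b).cosh).rpow_const (p := r + 1)
      (Or.inl (Real.cosh_pos _).ne')).div_const (b * (r + 1))
    refine h.congr_deriv ?_
    simp only [id, add_sub_cancel_right, mul_one]
    field_simp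
  rw [integral_eq_sub_of_hasDerivAt hderiv (hcont.intervalIntegrable _ _)]
  simp [sub_div]

/-- `cosh` at a positive multiple of the variable tends to infinity. -/
theorem tendsto_cosh_const_mul_atTop {b : ℝ} (hb : 0 < b) :
    Tendsto (fun x : ℝ => Real.cosh (b * x)) atTop atTop := by
  refine tendsto_atTop_mono (f := fun x : ℝ => Real.exp (b * x) / 2) (fun x => ?_) ?_
  · rw [Real.cosh_eq]
    linarith [Real.exp_pos (-(b * x))]
  · exact (Real.tendsto_exp_atTop.comp (tendsto_id.const_mul_atTop hb)).atTop_div_const two_pos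

/-- The spacetime average of the energy density
`ρ(t,x) = 15 a² cosh(at)⁻⁴ cosh(3ax)⁻⁴` of the singularity-free solution, taken
with the four-dimensional volume density
`F(t,x) = cosh(at)⁵ cosh(3ax)^{4/3} sinh(3ax)`, vanishes
(Raychaudhuri's 1998 observation; since `p = ρ/3`, the same holds for the pressure). -/
theorem spacetime_average_energy_density_vanishes
    (a : ℝ) (ha : 0 < a)
    (ρ F : ℝ → ℝ → ℝ)
    (hρ : ∀ t x, ρ t x = 15 * a ^ 2 * (Real.cosh (a * t)) ^ (-4 : ℝ) *
      (Real.cosh (3 * a * x)) ^ (-4 : ℝ))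
    (hF : ∀ t x, F t x = (Real.cosh (a * t)) ^ (5 : ℝ) *
      (Real.cosh (3 * a * x)) ^ ((4 : ℝ) / 3) * Real.sinh (3 * a * x)) :
    Tendsto
      (fun n : ℝ =>
        (∫ t in (-n)..n, ∫ x in (0:ℝ)..n, ρ t x * F t x) /
          ∫ t in (-n)..n, ∫ x in (0:ℝ)..n, F t x)
      atTop (nhds 0) := by
  have hb : 0 < 3 * a := by positivity
  have hnum : ∀ t x, ρ t x * F t x = (15 * a ^ 2 * Real.cosh (a * t)) *
      (Real.cosh (3 * a * x) ^ (-8 / 3 : ℝ) * Real.sinh (3 * a * x)) := by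
    intro t x
    have h₁ : Real.cosh (a * t) ^ (-4 : ℝ) * Real.cosh (a * t) ^ (5 : ℝ) =
        Real.cosh (a * t) := by
      rw [← Real.rpow_add (Real.cosh_pos _)]
      norm_num
    have h₂ : Real.cosh (3 * a * x) ^ (-4 : ℝ) * Real.cosh (3 * a * x) ^ ((4 : ℝ) / 3) =
        Real.cosh (3 * a * x) ^ (-8 / 3 : ℝ) := by
      rw [← Real.rpow_add (Real.cosh_pos _)]
      norm_num
    rw [hρ, hF, ← h₂]
    nth_rewrite 3 [← h₁]
    ring
  have hden : ∀ t x, F t x = Real.cosh (a * t) ^ (5 : ℝ) *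
      (Real.cosh (3 * a * x) ^ ((4 : ℝ) / 3) * Real.sinh (3 * a * x)) := by
    intro t x
    rw [hF, mul_assoc]
  simp_rw [hnum, hden, intervalIntegral.integral_const_mul, intervalIntegral.integral_mul_const,
    integral_cosh_rpow_mul_sinh hb.ne' (show (-8 / 3 : ℝ) + 1 ≠ 0 by norm_num),
    integral_cosh_rpow_mul_sinh hb.ne' (show (4 / 3 : ℝ) + 1 ≠ 0 by norm_num),
    intervalIntegral.integral_const_mul, mul_div_mul_comm]
  have htime : ∀ n : ℝ, 0 ≤ n →
      ‖15 * a ^ 2 * (∫ t in (-n)..n, Real.cosh (a * t)) /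
        ∫ t in (-n)..n, Real.cosh (a * t) ^ (5 : ℝ)‖ ≤ 15 * a ^ 2 := by
    intro n hn
    have hcosh : Continuous fun t : ℝ => Real.cosh (a * t) :=
      Real.continuous_cosh.comp (continuous_const.mul continuous_id)
    have hle : ∫ t in (-n)..n, Real.cosh (a * t) ≤
        ∫ t in (-n)..n, Real.cosh (a * t) ^ (5 : ℝ) := by
      refine integral_mono_on (by linarith) (hcosh.intervalIntegrable _ _)
        ((hcosh.rpow_const fun t => Or.inl (Real.cosh_pos _).ne').intervalIntegrable _ _)
        fun t _ => ?_
      exact Real.self_le_rpow_of_one_le (Real.one_le_cosh _) (by norm_num)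
    have hnonneg : 0 ≤ ∫ t in (-n)..n, Real.cosh (a * t) :=
      integral_nonneg (by linarith) fun t _ => (Real.cosh_pos _).le
    have hnonneg' := hnonneg.trans hle
    rw [Real.norm_of_nonneg (by positivity)]
    exact div_le_of_le_mul₀ hnonneg' (by positivity) (by gcongr)
  have hcosh := tendsto_cosh_const_mul_atTop hb
  have hspace : Tendsto (fun n : ℝ =>
      (Real.cosh (3 * a * n) ^ (-8 / 3 + 1 : ℝ) - 1) / (3 * a * (-8 / 3 + 1)) /
        ((Real.cosh (3 * a * n) ^ (4 / 3 + 1 : ℝ) - 1) / (3 * a * (4 / 3 + 1))))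
      atTop (nhds 0) := by
    refine Tendsto.div_atTop (a := (0 - 1) / (3 * a * (-8 / 3 + 1))) ?_ ?_
    · have h := (tendsto_rpow_neg_atTop (show (0 : ℝ) < 5 / 3 by norm_num)).comp hcosh
      rw [show (-(5 / 3) : ℝ) = -8 / 3 + 1 by norm_num] at h
      exact (h.sub_const 1).div_const _
    · have h := (tendsto_rpow_atTop (show (0 : ℝ) < 4 / 3 + 1 by norm_num)).comp hcosh
      exact (tendsto_atTop_add_const_right _ (-1) h).atTop_div_const (by positivity)
  exact isBoundedUnder_le_mul_tendsto_zero
    (isBoundedUnder_of_eventually_le ((eventually_ge_atTop 0).mono htime)) hspace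
end
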